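/- arXiv:2006.07569 — 5 statements merged into one kernel-verified Lean document; each statement's English description precedes it below -/
import Mathlib

section
/- Let A ∈ ℝ^{n×n}, B ∈ ℝ^{n×d}, Q ∈ ℝ^{n×n} symmetric positive semidefinite, R ∈ ℝ^{d×d} symmetric positive definite, and let P' ∈ ℝ^{n×n} be symmetric positive semidefinite. Set H' = B(R + BᵀP'B)⁻¹Bᵀ. Then for all x, w, v ∈ ℝ^n and q ∈ ℝ, the function u ↦ uᵀRu + (Ax + Bu + w)ᵀP'(Ax + Bu + w) + vᵀ(Ax + Bu + w) + q on ℝ^d attains its infimum uniquely at u* = −(R + BᵀP'B)⁻¹Bᵀ(P'Ax + P'w + v/2), and xᵀQx plus this infimum equals xᵀP''x + v''ᵀx + q'', where P'' = Q + AᵀP'A − AᵀP'H'P'A, v'' = (Aᵀ − AᵀP'H')(v + 2P'w), and q'' = wᵀ(P' − P'H'P')w + wᵀ(I − P'H')v − (1/4)vᵀH'v + q. -/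
open Matrix

theorem dotProduct_transpose_mulVec_eq {m k : ℕ} (M : Matrix (Fin m) (Fin k) ℝ)
    (x : Fin k → ℝ) (y : Fin m → ℝ) : x ⬝ᵥ Mᵀ *ᵥ y = (M *ᵥ x) ⬝ᵥ y := by
  rw [dotProduct_mulVec, vecMul_transpose]

theorem dotProduct_mulVec_comm_of_isSymm {m : ℕ} {M : Matrix (Fin m) (Fin m) ℝ}
    (hM : M.IsSymm) (x y : Fin m → ℝ) : x ⬝ᵥ M *ᵥ y = y ⬝ᵥ M *ᵥ x := by
  rw [dotProduct_comm y, ← dotProduct_transpose_mulVec_eq, hM.eq]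

/-- Completing the square for a quadratic form with symmetric invertible matrix. -/
theorem quadratic_complete_square {m : ℕ} {S : Matrix (Fin m) (Fin m) ℝ}
    (hS : S.IsSymm) (hdet : IsUnit S.det) (g u : Fin m → ℝ) :
    u ⬝ᵥ S *ᵥ u + 2 * (u ⬝ᵥ g)
      = (u + S⁻¹ *ᵥ g) ⬝ᵥ S *ᵥ (u + S⁻¹ *ᵥ g) - g ⬝ᵥ S⁻¹ *ᵥ g := by
  have hg : S *ᵥ (S⁻¹ *ᵥ g) = g := by
    rw [mulVec_mulVec, mul_nonsing_inv _ hdet, one_mulVec]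
  have hcross := dotProduct_mulVec_comm_of_isSymm hS (S⁻¹ *ᵥ g) u
  rw [hg] at hcross
  simp only [mulVec_add, add_dotProduct, dotProduct_add, hg, hcross]
  rw [dotProduct_comm (S⁻¹ *ᵥ g) g]
  ring

/-- One-step completion of the square for the LQR cost-to-go.  With
`H' = B(R + BᵀP'B)⁻¹Bᵀ`, the map
`u ↦ uᵀRu + (Ax + Bu + w)ᵀP'(Ax + Bu + w) + vᵀ(Ax + Bu + w) + q`
attains its infimum uniquely at `u* = −(R + BᵀP'B)⁻¹Bᵀ(P'Ax + P'w + v/2)`, and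
`xᵀQx` plus the minimum value equals `xᵀP''x + v''ᵀx + q''` with
`P'' = Q + AᵀP'A − AᵀP'H'P'A`, `v'' = (Aᵀ − AᵀP'H')(v + 2P'w)` and
`q'' = wᵀ(P' − P'H'P')w + wᵀ(I − P'H')v − (1/4)vᵀH'v + q`. -/
theorem stmt1 {n d : ℕ}
    (A : Matrix (Fin n) (Fin n) ℝ) (B : Matrix (Fin n) (Fin d) ℝ)
    (Q : Matrix (Fin n) (Fin n) ℝ) (R : Matrix (Fin d) (Fin d) ℝ)
    (P' : Matrix (Fin n) (Fin n) ℝ)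
    (hQ : Q.PosSemidef) (hR : R.PosDef) (hP' : P'.PosSemidef)
    (H' : Matrix (Fin n) (Fin n) ℝ) (hH' : H' = B * (R + Bᵀ * P' * B)⁻¹ * Bᵀ)
    (x w v : Fin n → ℝ) (q : ℝ)
    (f : (Fin d → ℝ) → ℝ)
    (hf : ∀ u, f u = u ⬝ᵥ R.mulVec u
        + (A.mulVec x + B.mulVec u + w) ⬝ᵥ P'.mulVec (A.mulVec x + B.mulVec u + w)
        + v ⬝ᵥ (A.mulVec x + B.mulVec u + w) + q)
    (ustar : Fin d → ℝ)
    (hustar : ustar = -(((R + Bᵀ * P' * B)⁻¹ * Bᵀ).mulVec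
        (P'.mulVec (A.mulVec x) + P'.mulVec w + (1 / 2 : ℝ) • v))) :
    (∀ u, u ≠ ustar → f ustar < f u) ∧
      x ⬝ᵥ Q.mulVec x + f ustar
        = x ⬝ᵥ (Q + Aᵀ * P' * A - Aᵀ * P' * H' * P' * A).mulVec x
          + ((Aᵀ - Aᵀ * P' * H').mulVec (v + (2 : ℝ) • P'.mulVec w)) ⬝ᵥ x
          + (w ⬝ᵥ (P' - P' * H' * P').mulVec w
            + w ⬝ᵥ ((1 : Matrix (Fin n) (Fin n) ℝ) - P' * H').mulVec v
            - (1 / 4 : ℝ) * (v ⬝ᵥ H'.mulVec v) + q) := by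
  have hPs : P'.IsSymm := by simpa using hP'.isHermitian
  have hRs : R.IsSymm := by simpa using hR.isHermitian
  have hS : (R + Bᵀ * P' * B).PosDef := by
    simpa using hR.add_posSemidef (hP'.conjTranspose_mul_mul_same B)
  generalize hSdef : R + Bᵀ * P' * B = S at hS hH' hustar
  have hSs : S.IsSymm := by simpa using hS.isHermitian
  have hdet : IsUnit S.det := hS.det_pos.ne'.isUnit
  have hHs : H'.IsSymm := by
    rw [hH', IsSymm, transpose_mul, transpose_mul, transpose_transpose,
      transpose_nonsing_inv, hSs.eq, Matrix.mul_assoc]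
  set z := P' *ᵥ (A *ᵥ x) + P' *ᵥ w + (1 / 2 : ℝ) • v with hz
  have hustar' : ustar = -(S⁻¹ *ᵥ (Bᵀ *ᵥ z)) := by rw [hustar, mulVec_mulVec]
  have hBH : (Bᵀ *ᵥ z) ⬝ᵥ S⁻¹ *ᵥ (Bᵀ *ᵥ z) = z ⬝ᵥ H' *ᵥ z := by
    rw [hH', ← mulVec_mulVec, ← mulVec_mulVec]
    simpa using (dotProduct_transpose_mulVec_eq Bᵀ z (S⁻¹ *ᵥ (Bᵀ *ᵥ z))).symm
  have hsq : ∀ u, f u = (u - ustar) ⬝ᵥ S *ᵥ (u - ustar) - z ⬝ᵥ H' *ᵥ z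
      + ((A *ᵥ x + w) ⬝ᵥ P' *ᵥ (A *ᵥ x + w) + v ⬝ᵥ (A *ᵥ x + w) + q) := by
    intro u
    have hc := quadratic_complete_square hSs hdet (Bᵀ *ᵥ z) u
    rw [hBH] at hc
    rw [hustar', sub_neg_eq_add, ← hc, hf, dotProduct_transpose_mulVec_eq, ← hSdef, hz]
    simp only [add_mulVec, mulVec_add, ← mulVec_mulVec, add_dotProduct, dotProduct_add,
      dotProduct_transpose_mulVec_eq, dotProduct_smul, smul_eq_mul]
    rw [dotProduct_mulVec_comm_of_isSymm hPs (A *ᵥ x) (B *ᵥ u),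
      dotProduct_mulVec_comm_of_isSymm hPs w (B *ᵥ u), dotProduct_comm v (B *ᵥ u)]
    ring
  refine ⟨fun u hu => ?_, ?_⟩
  · have hpos := hS.dotProduct_mulVec_pos (sub_ne_zero.mpr hu)
    rw [star_trivial] at hpos
    rw [hsq u, hsq ustar, sub_self, zero_dotProduct]
    linarith
  · have hP_left (a b : Fin n → ℝ) : a ⬝ᵥ P' *ᵥ b = (P' *ᵥ a) ⬝ᵥ b := by
      rw [← dotProduct_transpose_mulVec_eq, hPs.eq]
    rw [hsq ustar, sub_self, zero_dotProduct, hz, dotProduct_comm _ x]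
    simp only [add_mulVec, sub_mulVec, mulVec_add, mulVec_smul, ← mulVec_mulVec,
      add_dotProduct, dotProduct_add, dotProduct_sub, dotProduct_transpose_mulVec_eq,
      dotProduct_smul, smul_dotProduct, smul_eq_mul, one_mulVec, hP_left]
    rw [dotProduct_mulVec_comm_of_isSymm hHs v (P' *ᵥ (A *ᵥ x)),
      dotProduct_mulVec_comm_of_isSymm hHs v (P' *ᵥ w),
      dotProduct_mulVec_comm_of_isSymm hHs (P' *ᵥ w) (P' *ᵥ (A *ᵥ x)),
      dotProduct_comm v (A *ᵥ x), dotProduct_comm v w, ← hP_left w (A *ᵥ x),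
      dotProduct_comm w (P' *ᵥ (A *ᵥ x))]
    ring
end

section
/- Let P, H, F be real n×n matrices with H symmetric, and suppose ‖F^i‖ ≤ c·λ^i for all i ≥ 1 with constants c > 0 and 0 ≤ λ < 1. Let (w_i)_{i∈ℕ} be random vectors in ℝ^n (on a common probability space) such that 𝔼[‖w_s‖·‖w_t‖] ≤ m for all s, t and some m > 0. Then for every k ≥ 0, 𝔼[w_kᵀ P F^k H (Fᵀ)^k (P w_k + 2 Σ_{j=1}^∞ (Fᵀ)^j P w_{k+j})] ≤ ‖F^k‖² · (1 + 2cλ/(1 − λ)) · ‖H‖ · ‖P‖² · m. -/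
open Matrix MeasureTheory RealInnerProductSpace

/-- A matrix acting on Euclidean space (so that the Euclidean norm is available). -/
noncomputable def mapp {m k : ℕ} (M : Matrix (Fin m) (Fin k) ℝ)
    (x : EuclideanSpace ℝ (Fin k)) : EuclideanSpace ℝ (Fin m) :=
  (EuclideanSpace.equiv (Fin m) ℝ).symm (M.mulVec (EuclideanSpace.equiv (Fin k) ℝ x))

/-- The spectral norm (operator 2-norm) of a real square matrix. -/
noncomputable def specNorm {n : ℕ} (M : Matrix (Fin n) (Fin n) ℝ) : ℝ :=
  ‖Matrix.toEuclideanCLM (𝕜 := ℝ) M‖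

theorem norm_mapp_le {n : ℕ} (M : Matrix (Fin n) (Fin n) ℝ) (x : EuclideanSpace ℝ (Fin n)) :
    ‖mapp M x‖ ≤ specNorm M * ‖x‖ :=
  (Matrix.toEuclideanCLM (𝕜 := ℝ) M).le_opNorm x

theorem specNorm_nonneg {n : ℕ} (M : Matrix (Fin n) (Fin n) ℝ) : 0 ≤ specNorm M :=
  norm_nonneg _

theorem specNorm_mul_le {n : ℕ} (M N : Matrix (Fin n) (Fin n) ℝ) :
    specNorm (M * N) ≤ specNorm M * specNorm N := by
  unfold specNorm
  rw [map_mul]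
  exact norm_mul_le _ _

theorem specNorm_transpose {n : ℕ} (M : Matrix (Fin n) (Fin n) ℝ) :
    specNorm Mᵀ = specNorm M := by
  rw [← Matrix.conjTranspose_eq_transpose_of_trivial]
  exact Matrix.l2_opNorm_conjTranspose M

theorem specNorm_transpose_pow {n : ℕ} (M : Matrix (Fin n) (Fin n) ℝ) (i : ℕ) :
    specNorm (Mᵀ ^ i) = specNorm (M ^ i) := by
  rw [← Matrix.transpose_pow, specNorm_transpose]

section NonnegSeries

variable {Ω ι : Type*} [MeasurableSpace Ω] [Countable ι] {μ : Measure Ω} {f : ι → Ω → ℝ}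

theorem lintegral_tsum_ofReal_ne_top (hf0 : ∀ i ω, 0 ≤ f i ω) (hf : ∀ i, Integrable (f i) μ)
    (hs : Summable fun i => ∫ ω, f i ω ∂μ) :
    ∫⁻ ω, ∑' i, ENNReal.ofReal (f i ω) ∂μ ≠ ⊤ := by
  rw [lintegral_tsum fun i => (hf i).aemeasurable.ennreal_ofReal]
  simp_rw [← fun i => ofReal_integral_eq_lintegral_ofReal (hf i) (ae_of_all _ (hf0 i))]
  exact hs.tsum_ofReal_ne_top

theorem ae_summable_of_summable_integral (hf0 : ∀ i ω, 0 ≤ f i ω)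
    (hf : ∀ i, Integrable (f i) μ) (hs : Summable fun i => ∫ ω, f i ω ∂μ) :
    ∀ᵐ ω ∂μ, Summable fun i => f i ω := by
  filter_upwards [ae_lt_top' (AEMeasurable.tsum fun i =>
    (hf i).aemeasurable.ennreal_ofReal) (lintegral_tsum_ofReal_ne_top hf0 hf hs)] with ω hω
  have h := ENNReal.summable_toReal hω.ne
  simpa only [ENNReal.toReal_ofReal (hf0 _ ω)] using h

theorem integrable_tsum_of_summable_integral (hf0 : ∀ i ω, 0 ≤ f i ω)
    (hf : ∀ i, Integrable (f i) μ) (hs : Summable fun i => ∫ ω, f i ω ∂μ) :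
    Integrable (fun ω => ∑' i, f i ω) μ := by
  have h := integrable_toReal_of_lintegral_ne_top (AEMeasurable.tsum fun i =>
    (hf i).aemeasurable.ennreal_ofReal) (lintegral_tsum_ofReal_ne_top hf0 hf hs)
  refine h.congr (ae_of_all _ fun ω => ?_)
  simp only [ENNReal.tsum_toReal_eq fun _ => ENNReal.ofReal_ne_top,
    ENNReal.toReal_ofReal (hf0 _ ω)]

end NonnegSeries

theorem integral_le_of_ae_le_of_nonneg {Ω : Type*} [MeasurableSpace Ω] {μ : Measure Ω}
    {f g : Ω → ℝ} (hg : Integrable g μ) (hfg : ∀ᵐ ω ∂μ, f ω ≤ g ω) (h0 : 0 ≤ ∫ ω, g ω ∂μ) :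
    ∫ ω, f ω ∂μ ≤ ∫ ω, g ω ∂μ := by
  by_cases hf : Integrable f μ
  · exact integral_mono_ae hf hg hfg
  · rwa [integral_undef hf]

theorem inner_mapp_le {n : ℕ} (P H F : Matrix (Fin n) (Fin n) ℝ) (k : ℕ)
    (x y : EuclideanSpace ℝ (Fin n)) :
    ⟪x, mapp (P * F ^ k * H * (Fᵀ) ^ k) y⟫
      ≤ specNorm P * specNorm (F ^ k) ^ 2 * specNorm H * (‖x‖ * ‖y‖) := by
  have hM : specNorm (P * F ^ k * H * (Fᵀ) ^ k)
      ≤ specNorm P * specNorm (F ^ k) ^ 2 * specNorm H := by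
    calc specNorm (P * F ^ k * H * (Fᵀ) ^ k)
        ≤ specNorm P * specNorm (F ^ k) * specNorm H * specNorm (F ^ k) := by
          rw [← specNorm_transpose_pow F k]
          refine (specNorm_mul_le _ _).trans
            (mul_le_mul_of_nonneg_right ?_ (specNorm_nonneg _))
          refine (specNorm_mul_le _ _).trans
            (mul_le_mul_of_nonneg_right ?_ (specNorm_nonneg _))
          rw [specNorm_transpose_pow]
          exact specNorm_mul_le _ _
      _ = _ := by ring
  calc ⟪x, mapp (P * F ^ k * H * (Fᵀ) ^ k) y⟫
      ≤ ‖x‖ * ‖mapp (P * F ^ k * H * (Fᵀ) ^ k) y‖ := real_inner_le_norm _ _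
    _ ≤ ‖x‖ * (specNorm P * specNorm (F ^ k) ^ 2 * specNorm H * ‖y‖) := by
        gcongr
        exact (norm_mapp_le _ _).trans (by gcongr)
    _ = _ := by ring

theorem norm_add_two_smul_tsum_le {n : ℕ} {P F : Matrix (Fin n) (Fin n) ℝ} {c lam : ℝ}
    (hF : ∀ i : ℕ, 1 ≤ i → specNorm (F ^ i) ≤ c * lam ^ i)
    (x : EuclideanSpace ℝ (Fin n)) {v : ℕ → EuclideanSpace ℝ (Fin n)}
    (hv : Summable fun j => lam ^ (j + 1) * ‖v j‖) :
    ‖mapp P x + (2 : ℝ) • ∑' j : ℕ, mapp ((Fᵀ) ^ (j + 1)) (mapp P (v j))‖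
      ≤ specNorm P * (‖x‖ + 2 * c * ∑' j : ℕ, lam ^ (j + 1) * ‖v j‖) := by
  have hterm (j : ℕ) : ‖mapp ((Fᵀ) ^ (j + 1)) (mapp P (v j))‖
      ≤ c * specNorm P * (lam ^ (j + 1) * ‖v j‖) := by
    calc ‖mapp ((Fᵀ) ^ (j + 1)) (mapp P (v j))‖
        ≤ specNorm (F ^ (j + 1)) * ‖mapp P (v j)‖ := by
          rw [← specNorm_transpose_pow]
          exact norm_mapp_le _ _
      _ ≤ c * lam ^ (j + 1) * (specNorm P * ‖v j‖) :=
          mul_le_mul (hF _ (Nat.le_add_left 1 j)) (norm_mapp_le _ _) (norm_nonneg _)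
            ((specNorm_nonneg _).trans (hF _ (Nat.le_add_left 1 j)))
      _ = _ := by ring
  have hsum : ‖∑' j : ℕ, mapp ((Fᵀ) ^ (j + 1)) (mapp P (v j))‖
      ≤ c * specNorm P * ∑' j : ℕ, lam ^ (j + 1) * ‖v j‖ :=
    tsum_of_norm_bounded (hv.hasSum.mul_left _) hterm
  calc _ ≤ ‖mapp P x‖ + ‖(2 : ℝ) • ∑' j : ℕ, mapp ((Fᵀ) ^ (j + 1)) (mapp P (v j))‖ :=
        norm_add_le _ _
    _ ≤ specNorm P * ‖x‖ + 2 * (c * specNorm P * ∑' j : ℕ, lam ^ (j + 1) * ‖v j‖) := by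
        rw [norm_smul, Real.norm_ofNat]
        gcongr
        exact norm_mapp_le _ _
    _ = _ := by ring

/-- Stochastic bound on the per-step marginal term: for `‖Fⁱ‖ ≤ c·λⁱ` (i ≥ 1, λ < 1) and random
vectors with `𝔼[‖w_s‖·‖w_t‖] ≤ m`,
`𝔼[w_kᵀ P Fᵏ H (Fᵀ)ᵏ (P w_k + 2 Σ_{j≥1} (Fᵀ)ʲ P w_{k+j})]
  ≤ ‖Fᵏ‖² (1 + 2cλ/(1−λ)) ‖H‖ ‖P‖² m`. -/
theorem stmt8 {n : ℕ} (P H F : Matrix (Fin n) (Fin n) ℝ) (hH : H.IsSymm)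
    (c : ℝ) (hc : 0 < c) (lam : ℝ) (hlam0 : 0 ≤ lam) (hlam1 : lam < 1)
    (hF : ∀ i : ℕ, 1 ≤ i → specNorm (F ^ i) ≤ c * lam ^ i)
    (Ω : Type) [MeasurableSpace Ω] (ℙ : Measure Ω) [IsProbabilityMeasure ℙ]
    (w : ℕ → Ω → EuclideanSpace ℝ (Fin n))
    (hwm : ∀ i, AEStronglyMeasurable (w i) ℙ)
    (m : ℝ) (hm : 0 < m)
    (hint : ∀ s t, Integrable (fun ω => ‖w s ω‖ * ‖w t ω‖) ℙ)
    (hmom : ∀ s t, ∫ ω, ‖w s ω‖ * ‖w t ω‖ ∂ℙ ≤ m) :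
    ∀ k : ℕ,
      (∫ ω, ⟪w k ω, mapp (P * F ^ k * H * (Fᵀ) ^ k)
          (mapp P (w k ω)
            + (2 : ℝ) • ∑' j : ℕ, mapp ((Fᵀ) ^ (j + 1)) (mapp P (w (k + 1 + j) ω)))⟫ ∂ℙ)
        ≤ specNorm (F ^ k) ^ 2 * (1 + 2 * c * lam / (1 - lam)) * specNorm H
            * specNorm P ^ 2 * m := by
  intro k
  have hA : 0 ≤ specNorm P * specNorm (F ^ k) ^ 2 * specNorm H :=
    mul_nonneg (mul_nonneg (specNorm_nonneg _) (sq_nonneg _)) (specNorm_nonneg _)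
  set A := specNorm P * specNorm (F ^ k) ^ 2 * specNorm H
  have hP := specNorm_nonneg P
  let G : ℕ → Ω → ℝ := fun j ω => lam ^ (j + 1) * (‖w k ω‖ * ‖w (k + 1 + j) ω‖)
  have hG0 (j : ℕ) (ω : Ω) : 0 ≤ G j ω := by positivity
  have hG (j : ℕ) : Integrable (G j) ℙ := (hint _ _).const_mul _
  have hGm (j : ℕ) : ∫ ω, G j ω ∂ℙ ≤ lam ^ (j + 1) * m := by
    rw [integral_const_mul]
    exact mul_le_mul_of_nonneg_left (hmom _ _) (by positivity)
  have hgeom : HasSum (fun j : ℕ => lam ^ (j + 1) * m) (lam / (1 - lam) * m) := by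
    have h := ((hasSum_geometric_of_lt_one hlam0 hlam1).mul_left lam).mul_right m
    simpa only [← pow_succ', ← div_eq_mul_inv] using h
  have hGs : Summable fun j => ∫ ω, G j ω ∂ℙ :=
    .of_nonneg_of_le (fun j => integral_nonneg (hG0 j)) hGm hgeom.summable
  have hGsum := integrable_tsum_of_summable_integral hG0 hG hGs
  have hGle : ∫ ω, ∑' j, G j ω ∂ℙ ≤ lam / (1 - lam) * m := by
    rw [← integral_tsum_of_summable_integral_norm hG
      (by simpa only [Real.norm_of_nonneg (hG0 _ _)] using hGs)]
    exact (hGs.tsum_le_tsum hGm hgeom.summable).trans_eq hgeom.tsum_eq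
  have hgint : Integrable (fun ω => A * specNorm P *
      (‖w k ω‖ * ‖w k ω‖ + 2 * c * ∑' j, G j ω)) ℙ :=
    ((hint k k).add (hGsum.const_mul _)).const_mul _
  refine (integral_le_of_ae_le_of_nonneg hgint ?_ ?_).trans ?_
  · filter_upwards [ae_summable_of_summable_integral hG0 hG hGs] with ω hω
    rcases eq_or_ne (w k ω) 0 with h0 | h0
    · rw [h0, inner_zero_left]
      exact mul_nonneg (mul_nonneg hA hP) (add_nonneg (by positivity)
        (mul_nonneg (by positivity) (tsum_nonneg fun j => hG0 j ω)))
    have hGeq (j : ℕ) : G j ω = ‖w k ω‖ * (lam ^ (j + 1) * ‖w (k + 1 + j) ω‖) :=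
      mul_left_comm _ _ _
    have hv : Summable fun j => lam ^ (j + 1) * ‖w (k + 1 + j) ω‖ := by
      simp_rw [hGeq] at hω
      exact (summable_mul_left_iff (norm_ne_zero_iff.mpr h0)).mp hω
    refine (inner_mapp_le P H F k _ _).trans ?_
    calc _ ≤ A * (‖w k ω‖ * (specNorm P *
          (‖w k ω‖ + 2 * c * ∑' j : ℕ, lam ^ (j + 1) * ‖w (k + 1 + j) ω‖))) := by
          gcongr
          exact norm_add_two_smul_tsum_le hF _ hv
      _ = _ := by
          simp_rw [hGeq]
          rw [tsum_mul_left]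
          ring
  · exact integral_nonneg fun ω => mul_nonneg (mul_nonneg hA hP) (add_nonneg (by positivity)
      (mul_nonneg (by positivity) (tsum_nonneg fun j => hG0 j ω)))
  · rw [integral_const_mul, integral_add (hint k k) (hGsum.const_mul _), integral_const_mul]
    calc _ ≤ A * specNorm P * (m + 2 * c * (lam / (1 - lam) * m)) := by
          gcongr
          exact hmom k k
      _ = _ := by
          simp only [A]
          ring
end

section
/- (Game induction step for the scalar adversarial example with A = B = Q = R = 1 and Ω = [−1, 1].) Let a > 0 and 0 < b < 1 and c ∈ ℝ, and define g : ℝ → ℝ by g(x) = a x² + 2b|x| + c. Then for every x ∈ ℝ, sup_{w ∈ [−1,1]} inf_{u ∈ ℝ} [u² + (x + w + u)² + g(x + w + u)] = a' x² + 2 b' |x| + c', where a' = (a + 1)/(a + 2), b' = (a + b + 1)/(a + 2), and c' = c + (a + 1 + 2b − b²)/(a + 2). Moreover a' > 0 and 0 < b' < 1. -/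
/-- A uniform lower bound on the one-step cost from the disturbed state `s`. -/
lemma le_stage_cost {a b c : ℝ} (ha : 0 < a) (s u : ℝ) :
    s ^ 2 - (|s| - b) ^ 2 / (a + 2) + c ≤
      u ^ 2 + (s + u) ^ 2 + (a * (s + u) ^ 2 + 2 * b * |s + u| + c) := by
  obtain ⟨y, rfl⟩ : ∃ y, u = y - s := ⟨s + u, by ring⟩
  rw [add_sub_cancel]
  have ha2 : 0 < a + 2 := by linarith
  obtain ⟨d, hd⟩ : ∃ d, |s| - b = d * (a + 2) := ⟨(|s| - b) / (a + 2), by field_simp⟩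
  have hq : (|s| - b) ^ 2 / (a + 2) = d ^ 2 * (a + 2) := by rw [hd]; field_simp
  have hsy : s * y ≤ |s| * |y| := (le_abs_self _).trans_eq (abs_mul s y)
  have hsq := mul_nonneg ha2.le (sq_nonneg (|y| - d))
  have hs : |s| = d * (a + 2) + b := by linarith
  rw [hs] at hsy
  rw [hq]
  nlinarith [sq_abs y]

/-- Outside the dead zone `|s| < b` the lower bound `le_stage_cost` is attained. -/
lemma exists_stage_cost_eq {a b c : ℝ} (ha : 0 < a) {s : ℝ} (hs : b ≤ |s|) :
    ∃ u, u ^ 2 + (s + u) ^ 2 + (a * (s + u) ^ 2 + 2 * b * |s + u| + c) =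
      s ^ 2 - (|s| - b) ^ 2 / (a + 2) + c := by
  have ha2 : 0 < a + 2 := by linarith
  have hd : 0 ≤ (|s| - b) / (a + 2) := div_nonneg (by linarith) ha2.le
  rcases abs_cases s with ⟨h, -⟩ | ⟨h, -⟩ <;> rw [h] at hd ⊢
  · refine ⟨(s - b) / (a + 2) - s, ?_⟩
    rw [add_sub_cancel, abs_of_nonneg hd]
    field_simp
    ring
  · refine ⟨-((-s - b) / (a + 2)) - s, ?_⟩
    rw [add_sub_cancel, abs_neg, abs_of_nonneg hd]
    field_simp
    ring

lemma bddBelow_stage_cost {a b c : ℝ} (ha : 0 < a) (s : ℝ) :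
    BddBelow (Set.range fun u : ℝ =>
      u ^ 2 + (s + u) ^ 2 + (a * (s + u) ^ 2 + 2 * b * |s + u| + c)) :=
  ⟨_, Set.forall_mem_range.2 (le_stage_cost ha s)⟩

lemma iInf_stage_cost {a b c : ℝ} (ha : 0 < a) {s : ℝ} (hs : b ≤ |s|) :
    ⨅ u : ℝ, (u ^ 2 + (s + u) ^ 2 + (a * (s + u) ^ 2 + 2 * b * |s + u| + c)) =
      s ^ 2 - (|s| - b) ^ 2 / (a + 2) + c := by
  obtain ⟨u, hu⟩ := exists_stage_cost_eq (c := c) ha hs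
  exact le_antisymm ((ciInf_le (bddBelow_stage_cost ha s) u).trans_eq hu)
    (le_ciInf (le_stage_cost ha s))

lemma sq_sub_sq_div_le {a b r t : ℝ} (ha : 0 < a) (hb : 0 < b) (hr : b ≤ r) (hrt : r ≤ t) :
    r ^ 2 - (r - b) ^ 2 / (a + 2) ≤ t ^ 2 - (t - b) ^ 2 / (a + 2) := by
  have h : (t - b) ^ 2 / (a + 2) - (r - b) ^ 2 / (a + 2) ≤ t ^ 2 - r ^ 2 := by
    rw [← sub_div, div_le_iff₀ (by linarith)]
    nlinarith [mul_nonneg (sub_nonneg.2 hrt) hb.le,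
      mul_nonneg (mul_nonneg (sub_nonneg.2 hrt) (by linarith : 0 ≤ t + r)) ha.le,
      mul_nonneg (sub_nonneg.2 hrt) (by linarith : 0 ≤ t + r)]
  linarith

lemma iInf_stage_cost_le {a b c : ℝ} (ha : 0 < a) (hb : 0 < b) {s t : ℝ} (hst : |s| ≤ t)
    (hbt : b ≤ t) :
    ⨅ u : ℝ, (u ^ 2 + (s + u) ^ 2 + (a * (s + u) ^ 2 + 2 * b * |s + u| + c)) ≤
      t ^ 2 - (t - b) ^ 2 / (a + 2) + c := by
  rcases le_total b |s| with h | h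
  · rw [iInf_stage_cost ha h, ← sq_abs s]
    linarith [sq_sub_sq_div_le ha hb h hst]
  · refine (ciInf_le (bddBelow_stage_cost ha s) (-s)).trans ?_
    have hsb : s ^ 2 ≤ b ^ 2 := sq_le_sq' (abs_le.1 h).1 (abs_le.1 h).2
    have := sq_sub_sq_div_le ha hb le_rfl hbt
    simp at this ⊢
    linarith

/-- One-step backward-induction identity for the scalar adversarial game with
`A = B = Q = R = 1` and `Ω = [−1, 1]`: if `g x = a x² + 2b|x| + c` with `a > 0`, `0 < b < 1`,
then `sup_{w∈[−1,1]} inf_u [u² + (x+w+u)² + g(x+w+u)] = a' x² + 2b'|x| + c'` where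
`a' = (a+1)/(a+2)`, `b' = (a+b+1)/(a+2)`, `c' = c + (a+1+2b−b²)/(a+2)`; moreover `a' > 0` and
`0 < b' < 1`. -/
theorem stmt12 (a b c : ℝ) (ha : 0 < a) (hb0 : 0 < b) (hb1 : b < 1)
    (g : ℝ → ℝ) (hg : ∀ x, g x = a * x ^ 2 + 2 * b * |x| + c) :
    (∀ x : ℝ,
      sSup ((fun w => ⨅ u : ℝ, (u ^ 2 + (x + w + u) ^ 2 + g (x + w + u))) ''
          Set.Icc (-1 : ℝ) 1)
        = (a + 1) / (a + 2) * x ^ 2 + 2 * ((a + b + 1) / (a + 2)) * |x|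
          + (c + (a + 1 + 2 * b - b ^ 2) / (a + 2)))
    ∧ 0 < (a + 1) / (a + 2)
    ∧ 0 < (a + b + 1) / (a + 2) ∧ (a + b + 1) / (a + 2) < 1 := by
  have ha2 : 0 < a + 2 := by linarith
  refine ⟨fun x => ?_, by positivity, by positivity, (div_lt_one ha2).2 (by linarith)⟩
  simp only [hg]
  have hval : (a + 1) / (a + 2) * x ^ 2 + 2 * ((a + b + 1) / (a + 2)) * |x|
      + (c + (a + 1 + 2 * b - b ^ 2) / (a + 2)) =
      (|x| + 1) ^ 2 - (|x| + 1 - b) ^ 2 / (a + 2) + c := by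
    rw [← sq_abs x]
    field_simp
    ring
  have hbt : b ≤ |x| + 1 := by linarith [abs_nonneg x]
  rw [hval]
  apply IsGreatest.csSup_eq
  constructor
  · obtain ⟨w, hw, hxw⟩ : ∃ w ∈ Set.Icc (-1 : ℝ) 1, |x + w| = |x| + 1 := by
      rcases le_total 0 x with h | h
      · exact ⟨1, by simp, by rw [abs_of_nonneg h, abs_of_nonneg (by linarith)]⟩
      · exact ⟨-1, by simp, by rw [abs_of_nonpos h, abs_of_nonpos (by linarith)]; ring⟩
    refine ⟨w, hw, ?_⟩
    dsimp only
    rw [iInf_stage_cost ha (hxw ▸ hbt), ← sq_abs (x + w), hxw]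
  · rintro _ ⟨w, hw, rfl⟩
    exact iInf_stage_cost_le ha hb0
      ((abs_add_le x w).trans (by linarith [abs_le.2 hw])) hbt
end

section
/- (Inner minimization for the scalar adversarial example.) Let a > 0, b > 0, z ∈ ℝ. Consider φ(y) = (y − z)² + y² + a y² + 2b|y| on ℝ. If |z| ≤ b, then inf_y φ(y) = z², attained uniquely at y = 0. If |z| > b, then inf_y φ(y) = ((a + 1)/(a + 2)) z² + (2b/(a + 2)) |z| − b²/(a + 2), attained uniquely at y* = (z − b·sign(z))/(a + 2). -/
/-- Completing the square in the cost, for a sign `s` of `z`. -/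
theorem cost_eq_min_add_sq {a b z s : ℝ} (ha : a + 2 ≠ 0) (hs : s ^ 2 = 1) (hsz : s * z = |z|)
    (y : ℝ) :
    (y - z) ^ 2 + y ^ 2 + a * y ^ 2 + 2 * b * |y| =
      (a + 1) / (a + 2) * z ^ 2 + 2 * b / (a + 2) * |z| - b ^ 2 / (a + 2) +
        (a + 2) * (y - (z - b * s) / (a + 2)) ^ 2 + 2 * b * (|y| - s * y) := by
  rw [← hsz]
  field_simp
  linear_combination -b ^ 2 * hs

/-- Inner minimization for the scalar adversarial example: for
`φ(y) = (y − z)² + y² + a y² + 2b|y|` with `a, b > 0`, if `|z| ≤ b` the infimum is `z²`,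
attained uniquely at `y = 0`; if `|z| > b` the infimum is
`((a+1)/(a+2)) z² + (2b/(a+2))|z| − b²/(a+2)`, attained uniquely at
`y* = (z − b·sign z)/(a+2)`. -/
theorem stmt13 (a b z : ℝ) (ha : 0 < a) (hb : 0 < b)
    (φ : ℝ → ℝ) (hφ : ∀ y, φ y = (y - z) ^ 2 + y ^ 2 + a * y ^ 2 + 2 * b * |y|) :
    (|z| ≤ b → φ 0 = z ^ 2 ∧ ∀ y : ℝ, y ≠ 0 → z ^ 2 < φ y) ∧
    (b < |z| →
      φ ((z - b * Real.sign z) / (a + 2))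
          = (a + 1) / (a + 2) * z ^ 2 + 2 * b / (a + 2) * |z| - b ^ 2 / (a + 2) ∧
        ∀ y : ℝ, y ≠ (z - b * Real.sign z) / (a + 2) →
          (a + 1) / (a + 2) * z ^ 2 + 2 * b / (a + 2) * |z| - b ^ 2 / (a + 2) < φ y) := by
  simp only [hφ]
  refine ⟨fun hz => ⟨by simp, fun y hy => ?_⟩, fun hz => ?_⟩
  · have hzy : z * y ≤ b * |y| :=
      (le_abs_self _).trans (abs_mul z y ▸ mul_le_mul_of_nonneg_right hz (abs_nonneg y))
    have hy2 : 0 < (a + 2) * y ^ 2 := by positivity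
    linarith
  · have ha2 : 0 < a + 2 := by linarith
    have hsz : Real.sign z * z = |z| := by
      rcases lt_trichotomy z 0 with h | rfl | h
      · simp [Real.sign_of_neg h, abs_of_neg h]
      · simp
      · simp [Real.sign_of_pos h, abs_of_pos h]
    have hz0 : z ≠ 0 := abs_pos.mp (hb.trans hz)
    have hs : Real.sign z = -1 ∨ Real.sign z = 1 := Real.sign_apply_eq_of_ne_zero z hz0
    have hs2 : Real.sign z ^ 2 = 1 := by rcases hs with h | h <;> simp [h]
    have hle (y : ℝ) : Real.sign z * y ≤ |y| := by
      rcases hs with h | h <;> simp [h, neg_le_abs, le_abs_self]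
    simp only [cost_eq_min_add_sq ha2.ne' hs2 hsz]
    refine ⟨?_, fun y hy => ?_⟩
    · have hmul : Real.sign z * ((z - b * Real.sign z) / (a + 2)) = (|z| - b) / (a + 2) := by
        rw [← hsz]
        linear_combination -b / (a + 2) * hs2
      have habs : |(z - b * Real.sign z) / (a + 2)| =
          Real.sign z * ((z - b * Real.sign z) / (a + 2)) := by
        have h0 : 0 ≤ (|z| - b) / (a + 2) := div_nonneg (by linarith) ha2.le
        rw [hmul, ← abs_of_nonneg h0, ← hmul, abs_mul]
        rcases hs with h | h <;> simp [h]
      rw [habs]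
      ring
    · have hsq : 0 < (a + 2) * (y - (z - b * Real.sign z) / (a + 2)) ^ 2 :=
        mul_pos ha2 (sq_pos_of_ne_zero (sub_ne_zero.mpr hy))
      have := mul_nonneg hb.le (sub_nonneg.mpr (hle y))
      linarith
end

section
/- Define sequences (a_i)_{i≥1}, (b_i)_{i≥1} by a₁ = b₁ = 1/2, a_{i+1} = (a_i + 1)/(a_i + 2), and b_{i+1} = (a_i + b_i + 1)/(a_i + 2). Then: (i) 1 − b_{i+1} = (1 − b_i)/(a_i + 2) for all i; (ii) 0 < b_i < 1 for all i and b_i → 1; and (iii) the per-step cost increments δ_i = (a_i + 1 + 2b_i − b_i²)/(a_i + 2) converge to 1 as i → ∞. Consequently, with c₁ = 1/2 and c_{i+1} = c_i + δ_i, one has c_i / i → 1, i.e., the long-run average value of the scalar adversarial game with one prediction equals 1 (ADV₁ = 1). -/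
open Filter Topology

/-- Coefficient recursions of the scalar adversarial game with one prediction
(`A = B = Q = R = 1`, `Ω = [−1,1]`): with `a₁ = b₁ = 1/2`, `a_{i+1} = (a_i+1)/(a_i+2)`,
`b_{i+1} = (a_i+b_i+1)/(a_i+2)`, one has (i) `1 − b_{i+1} = (1 − b_i)/(a_i+2)`;
(ii) `0 < b_i < 1` and `b_i → 1`; (iii) the increments
`δ_i = (a_i + 1 + 2b_i − b_i²)/(a_i+2)` tend to `1`; consequently, for `c₁ = 1/2`,
`c_{i+1} = c_i + δ_i`, one has `c_i/i → 1` (so `ADV₁ = 1`). -/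
theorem stmt15 (a b : ℕ → ℝ) (ha1 : a 1 = 1 / 2) (hb1 : b 1 = 1 / 2)
    (harec : ∀ i : ℕ, 1 ≤ i → a (i + 1) = (a i + 1) / (a i + 2))
    (hbrec : ∀ i : ℕ, 1 ≤ i → b (i + 1) = (a i + b i + 1) / (a i + 2))
    (c : ℕ → ℝ) (hc1 : c 1 = 1 / 2)
    (hcrec : ∀ i : ℕ, 1 ≤ i →
      c (i + 1) = c i + (a i + 1 + 2 * b i - (b i) ^ 2) / (a i + 2)) :
    (∀ i : ℕ, 1 ≤ i → 1 - b (i + 1) = (1 - b i) / (a i + 2)) ∧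
    (∀ i : ℕ, 1 ≤ i → 0 < b i ∧ b i < 1) ∧
    Tendsto b atTop (𝓝 1) ∧
    Tendsto (fun i : ℕ => (a i + 1 + 2 * b i - (b i) ^ 2) / (a i + 2)) atTop (𝓝 1) ∧
    Tendsto (fun i : ℕ => c i / i) atTop (𝓝 1) := by
  have hapos : ∀ i : ℕ, 1 ≤ i → 0 < a i := by
    intro i hi
    induction i, hi using Nat.le_induction with
    | base => norm_num [ha1]
    | succ i hi ih => rw [harec i hi]; positivity
  have hgap : ∀ i : ℕ, 1 ≤ i → 1 - b (i + 1) = (1 - b i) / (a i + 2) := by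
    intro i hi
    have := hapos i hi
    rw [hbrec i hi]
    field_simp
    ring
  have hgeom : ∀ i : ℕ, 1 ≤ i → 0 < 1 - b i ∧ 1 - b i ≤ (1 / 2) ^ i := by
    intro i hi
    induction i, hi using Nat.le_induction with
    | base => norm_num [hb1]
    | succ i hi ih =>
      have := hapos i hi
      rw [hgap i hi]
      refine ⟨div_pos ih.1 (by linarith), ?_⟩
      rw [div_le_iff₀ (by linarith), pow_succ]
      nlinarith [pow_pos (one_half_pos (α := ℝ)) i]
  have hb : ∀ i : ℕ, 1 ≤ i → 0 < b i ∧ b i < 1 := by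
    intro i hi
    have h := hgeom i hi
    have : (1 / 2 : ℝ) ^ i ≤ 1 / 2 := pow_le_of_le_one (by norm_num) (by norm_num) (by lia)
    exact ⟨by linarith, by linarith⟩
  have hδ : ∀ i : ℕ, 1 ≤ i →
      (a i + 1 + 2 * b i - (b i) ^ 2) / (a i + 2) = 1 - (1 - b i) ^ 2 / (a i + 2) := by
    intro i hi
    have := hapos i hi
    field_simp
    ring
  have hpow : Tendsto (fun i : ℕ => 1 - (1 / 2 : ℝ) ^ i) atTop (𝓝 1) := by
    simpa using (tendsto_pow_atTop_nhds_zero_of_lt_one (r := (1 / 2 : ℝ))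
      (by norm_num) (by norm_num)).const_sub 1
  -- The gap `i - c i` stays bounded: adding `1 - b i` to it gives a nonincreasing quantity.
  have hc : ∀ i : ℕ, 1 ≤ i → 0 ≤ i - c i ∧ i - c i + (1 - b i) ≤ 1 := by
    intro i hi
    induction i, hi using Nat.le_induction with
    | base => norm_num [hc1, hb1]
    | succ i hi ih =>
      have hai := hapos i hi
      have hbi := hb i hi
      have hstep : (1 - b i) ^ 2 / (a i + 2) + (1 - b i) / (a i + 2) ≤ 1 - b i := by
        rw [← add_div, div_le_iff₀ (by linarith)]
        nlinarith
      have hnonneg : 0 ≤ (1 - b i) ^ 2 / (a i + 2) := by positivity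
      rw [hgap i hi, hcrec i hi, hδ i hi]
      push_cast
      exact ⟨by linarith, by linarith⟩
  refine ⟨hgap, hb, ?_, ?_, ?_⟩
  · refine tendsto_of_tendsto_of_tendsto_of_le_of_le' hpow tendsto_const_nhds ?_ ?_
    · filter_upwards [eventually_ge_atTop 1] with i hi
      linarith [(hgeom i hi).2]
    · filter_upwards [eventually_ge_atTop 1] with i hi
      exact (hb i hi).2.le
  · refine tendsto_of_tendsto_of_tendsto_of_le_of_le' hpow tendsto_const_nhds ?_ ?_
    · filter_upwards [eventually_ge_atTop 1] with i hi
      have := hapos i hi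
      have : (1 - b i) ^ 2 / (a i + 2) ≤ 1 - b i := by
        rw [div_le_iff₀ (by linarith)]
        nlinarith [hb i hi]
      linarith [hδ i hi, (hgeom i hi).2]
    · filter_upwards [eventually_ge_atTop 1] with i hi
      have := hapos i hi
      rw [hδ i hi]
      exact sub_le_self _ (by positivity)
  · have hinv : Tendsto (fun i : ℕ => 1 - 1 / (i : ℝ)) atTop (𝓝 1) := by
      simpa using (tendsto_one_div_atTop_nhds_zero_nat (𝕜 := ℝ)).const_sub 1
    refine tendsto_of_tendsto_of_tendsto_of_le_of_le' hinv tendsto_const_nhds ?_ ?_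
    · filter_upwards [eventually_ge_atTop 1] with i hi
      have hi0 : (0 : ℝ) < i := by exact_mod_cast hi
      rw [one_sub_div hi0.ne']
      gcongr
      linarith [hc i hi, hb i hi]
    · filter_upwards [eventually_ge_atTop 1] with i hi
      have hi0 : (0 : ℝ) < i := by exact_mod_cast hi
      rw [div_le_one hi0]
      linarith [hc i hi]
end
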